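/- Let c_1,…,c_k > 0 with ∑_{i=1}^k c_i = 1 and k ≥ 2, and let f_1,…,f_k ∈ L^1(ℝ^n) be non-negative. Then ∫*_{ℝ^n} sup{∏_{i=1}^k f_i(x_i)^{c_i} : x = ∑_{i=1}^k c_i x_i} dx ≥ ∏_{i=1}^k (∫_{ℝ^n} f_i)^{c_i}. Moreover, if ∫_{ℝ^n} f_i > 0 for all i and equality holds, then there exist a_1,…,a_k > 0, w_1,…,w_k ∈ ℝ^n with ∑_{i=1}^k c_i w_i = o, and a log-concave function φ such that f_i(x) = a_i φ(x + w_i) for almost every x ∈ ℝ^n. -/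

import Mathlib

open MeasureTheory
open scoped ENNReal

/-- The outer integral of a (possibly non-measurable) non-negative function: the infimum
of the integrals of measurable functions dominating it. -/
noncomputable def outerLintegral {α : Type*} [MeasurableSpace α] (μ : Measure α)
    (f : α → ℝ≥0∞) : ℝ≥0∞ :=
  ⨅ (g : α → ℝ≥0∞) (_ : Measurable g) (_ : ∀ x, f x ≤ g x), ∫⁻ x, g x ∂μ

/-- A non-negative function is log-concave if
`f((1-λ)x + λy) ≥ f(x)^{1-λ} f(y)^λ` for all `x, y` and `λ ∈ (0,1)`. -/
def IsLogConcave {V : Type*} [AddCommGroup V] [Module ℝ V] (f : V → ℝ) : Prop :=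
  ∀ x y : V, ∀ t : ℝ, 0 < t → t < 1 →
    f x ^ (1 - t) * f y ^ t ≤ f ((1 - t) • x + t • y)

open Filter Topology Set
open scoped Pointwise

section OneDimension

theorem Real.volume_add_le_volume_add {K L : Set ℝ} (hK : IsCompact K) (hL : IsCompact L)
    (hK' : K.Nonempty) (hL' : L.Nonempty) :
    volume K + volume L ≤ volume (K + L) := by
  set a := sSup K
  set b := sInf L
  have ha : a ∈ K := hK.sSup_mem hK'
  have hb : b ∈ L := hL.sInf_mem hL'
  have hKa : ∀ x ∈ K, x ≤ a := fun x hx => le_csSup hK.bddAbove hx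
  have hLb : ∀ x ∈ L, b ≤ x := fun x hx => csInf_le hL.bddBelow hx
  have hsub : ((fun x => x + b) '' K) ∪ ((fun x => a + x) '' L) ⊆ K + L := by
    rintro _ (⟨x, hx, rfl⟩ | ⟨x, hx, rfl⟩)
    · exact Set.add_mem_add hx hb
    · exact Set.add_mem_add ha hx
  refine le_trans (le_of_eq ?_) (measure_mono hsub)
  rw [measure_union₀ (hL.image (by fun_prop)).measurableSet.nullMeasurableSet]
  · congr 1
    · rw [Set.image_add_right, measure_preimage_add_right]
    · rw [Set.image_add_left, measure_preimage_add]
  · refine measure_mono_null ?_ (measure_singleton (a + b))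
    rintro _ ⟨⟨x, hx, rfl⟩, ⟨y, hy, hxy⟩⟩
    have := hKa x hx
    have := hLb y hy
    simp only [Set.mem_singleton_iff] at *
    linarith

theorem Real.sum_volume_le_volume_sum {ι : Type*} (s : Finset ι) {K : ι → Set ℝ}
    (hK : ∀ i, IsCompact (K i)) (hK' : ∀ i, (K i).Nonempty) :
    IsCompact (∑ i ∈ s, K i) ∧ (∑ i ∈ s, K i).Nonempty ∧
      ∑ i ∈ s, volume (K i) ≤ volume (∑ i ∈ s, K i) := by
  classical
  induction s using Finset.induction_on with
  | empty => simp
  | insert a s ha ih =>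
    obtain ⟨h1, h2, h3⟩ := ih
    simp only [Finset.sum_insert ha]
    exact ⟨(hK a).add h1, (hK' a).add h2,
      (add_le_add le_rfl h3).trans (Real.volume_add_le_volume_add (hK a) h1 (hK' a) h2)⟩

theorem exists_seq_isCompact_tendsto_volume {A : Set ℝ} (hA : MeasurableSet A)
    (hA' : A.Nonempty) :
    ∃ K : ℕ → Set ℝ, (∀ m, IsCompact (K m)) ∧ (∀ m, (K m).Nonempty) ∧ (∀ m, K m ⊆ A) ∧
      Tendsto (fun m => volume (K m)) atTop (𝓝 (volume A)) := by
  rcases eq_or_ne (volume A) 0 with h0 | h0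
  · obtain ⟨x, hx⟩ := hA'
    exact ⟨fun _ => {x}, fun _ => isCompact_singleton, fun _ => singleton_nonempty x,
      fun _ => singleton_subset_iff.2 hx, by simp [h0]⟩
  · obtain ⟨r, -, hr, hr'⟩ := exists_seq_strictMono_tendsto' (pos_iff_ne_zero.2 h0)
    choose K hKA hK hrK using fun m => hA.exists_lt_isCompact (hr m).2
    refine ⟨K, hK, fun m => nonempty_of_measure_ne_zero (ne_bot_of_gt (hrK m)), hKA, ?_⟩
    exact tendsto_of_tendsto_of_tendsto_of_le_of_le hr' tendsto_const_nhds
      (fun m => (hrK m).le) (fun m => measure_mono (hKA m))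

variable {ι : Type*} [Fintype ι]

theorem Real.sum_volume_le_of_sum_mem {A : ι → Set ℝ} {B : Set ℝ}
    (hA : ∀ i, MeasurableSet (A i)) (hA' : ∀ i, (A i).Nonempty)
    (hB : ∀ x : ι → ℝ, (∀ i, x i ∈ A i) → ∑ i, x i ∈ B) :
    ∑ i, volume (A i) ≤ volume B := by
  choose K hK hK' hKA hlim using fun i => exists_seq_isCompact_tendsto_volume (hA i) (hA' i)
  refine le_of_tendsto' (tendsto_finsetSum Finset.univ fun i _ => hlim i) fun m => ?_
  refine (Real.sum_volume_le_volume_sum Finset.univ (fun i => hK i m) (fun i => hK' i m)).2.2.trans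
    (measure_mono ?_)
  intro y hy
  obtain ⟨x, hx, rfl⟩ := Set.mem_fintype_sum _ _ |>.1 hy
  exact hB x fun i => hKA i m (hx i)

theorem Real.sum_smul_volume_le_of_sum_mem {c : ι → ℝ} (hc : ∀ i, 0 < c i) {A : ι → Set ℝ}
    {B : Set ℝ} (hA : ∀ i, MeasurableSet (A i)) (hA' : ∀ i, (A i).Nonempty)
    (hB : ∀ x : ι → ℝ, (∀ i, x i ∈ A i) → ∑ i, c i • x i ∈ B) :
    ∑ i, ENNReal.ofReal (c i) * volume (A i) ≤ volume B := by
  have := Real.sum_volume_le_of_sum_mem (A := fun i => c i • A i) (B := B)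
    (fun i => (hA i).const_smul_of_ne_zero (hc i).ne') (fun i => (hA' i).smul_set) ?_
  · simpa [Measure.addHaar_smul, abs_of_pos (hc _)] using this
  · intro x hx
    choose y hy hxy using hx
    simpa only [hxy] using hB y hy

theorem sum_lintegral_le_of_prod_le {c : ι → ℝ} (hc : ∀ i, 0 < c i) (hsum : ∑ i, c i = 1)
    {g : ι → ℝ → ℝ} {h : ℝ → ℝ} (hg : ∀ i, Measurable (g i)) (hh : Measurable h)
    (hg0 : ∀ i x, 0 ≤ g i x) (hg1 : ∀ i x, g i x ≤ 1) (hsup : ∀ i, ∀ r < 1, ∃ x, r < g i x)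
    (hh0 : ∀ x, 0 ≤ h x)
    (hle : ∀ x : ι → ℝ, ∏ i, g i (x i) ^ c i ≤ h (∑ i, c i • x i)) :
    ∑ i, ENNReal.ofReal (c i) * ∫⁻ x, ENNReal.ofReal (g i x) ≤ ∫⁻ x, ENNReal.ofReal (h x) := by
  have hanti : ∀ i, Measurable fun r : ℝ => volume {x | r < g i x} := fun i =>
    Antitone.measurable fun r s hrs => measure_mono fun x (hx : s < g i x) => hrs.trans_lt hx
  simp_rw [fun i => lintegral_eq_lintegral_meas_lt volume (ae_of_all _ (hg0 i))
    (hg i).aemeasurable]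
  rw [lintegral_eq_lintegral_meas_lt volume (ae_of_all _ hh0) hh.aemeasurable]
  simp_rw [← lintegral_const_mul _ (hanti _)]
  rw [← lintegral_finsetSum _ fun i _ => (hanti i).const_mul _]
  refine setLIntegral_mono' measurableSet_Ioi fun r (hr : 0 < r) => ?_
  rcases lt_or_ge r 1 with hr1 | hr1
  · refine Real.sum_smul_volume_le_of_sum_mem hc
      (fun i => measurableSet_lt measurable_const (hg i)) (fun i => hsup i r hr1) ?_
    intro x hx
    refine lt_of_lt_of_le ?_ (hle x)
    have hne : (Finset.univ : Finset ι).Nonempty := by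
      by_contra hne
      rw [Finset.not_nonempty_iff_eq_empty] at hne
      simp [hne] at hsum
    calc r = ∏ i, r ^ c i := by
          rw [← Real.rpow_sum_of_pos hr, hsum, Real.rpow_one]
      _ < ∏ i, g i (x i) ^ c i :=
          Finset.prod_lt_prod_of_nonempty (fun i _ => Real.rpow_pos_of_pos hr _)
            (fun i _ => Real.rpow_lt_rpow hr.le (hx i) (hc i)) hne
  · have : ∀ i, {x | r < g i x} = ∅ := fun i => by
      ext x; simpa using (hg1 i x).trans hr1
    simp [this]

end OneDimension

theorem ENNReal.geom_mean_le_arith_mean {ι : Type*} [Fintype ι] {c : ι → ℝ}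
    (hc : ∀ i, 0 < c i) (hsum : ∑ i, c i = 1) (z : ι → ℝ≥0∞) :
    ∏ i, z i ^ c i ≤ ∑ i, ENNReal.ofReal (c i) * z i := by
  by_cases htop : ∃ i, z i = ∞
  · obtain ⟨i, hi⟩ := htop
    have : ∑ i, ENNReal.ofReal (c i) * z i = ∞ := by
      rw [ENNReal.sum_eq_top]
      exact ⟨i, Finset.mem_univ i, by simp [hi, ENNReal.mul_top, hc i]⟩
    simp [this]
  · push Not at htop
    have h := ENNReal.ofReal_le_ofReal (Real.geom_mean_le_arith_mean_weighted Finset.univ c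
      (fun i => (z i).toReal) (fun i _ => (hc i).le) hsum (fun i _ => ENNReal.toReal_nonneg))
    rw [ENNReal.ofReal_prod_of_nonneg (fun i _ => Real.rpow_nonneg ENNReal.toReal_nonneg _),
      ENNReal.ofReal_sum_of_nonneg
        (fun i _ => mul_nonneg (hc i).le ENNReal.toReal_nonneg)] at h
    refine (le_of_eq ?_).trans (h.trans (le_of_eq ?_))
    · refine Finset.prod_congr rfl fun i _ => ?_
      rw [← ENNReal.ofReal_rpow_of_nonneg ENNReal.toReal_nonneg (hc i).le,
        ENNReal.ofReal_toReal (htop i)]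
    · refine Finset.sum_congr rfl fun i _ => ?_
      rw [ENNReal.ofReal_mul (hc i).le, ENNReal.ofReal_toReal (htop i)]

/-- The measurable Prékopa–Leindler inequality on `E` with weights `c`. -/
def SatisfiesPrekopaLeindler (E : Type*) [AddCommMonoid E] [Module ℝ E] [MeasureSpace E]
    {ι : Type*} [Fintype ι] (c : ι → ℝ) : Prop :=
  ∀ (f : ι → E → ℝ≥0∞) (h : E → ℝ≥0∞), (∀ i, Measurable (f i)) → Measurable h →
    (∀ x : ι → E, ∏ i, f i (x i) ^ c i ≤ h (∑ i, c i • x i)) →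
    ∏ i, (∫⁻ x, f i x) ^ c i ≤ ∫⁻ x, h x

namespace SatisfiesPrekopaLeindler

variable {ι : Type*} [Fintype ι] {c : ι → ℝ}

theorem of_bounded (hc : ∀ i, 0 < c i) (hsum : ∑ i, c i = 1)
    {f : ι → ℝ → ℝ≥0∞} {h : ℝ → ℝ≥0∞} (hf : ∀ i, Measurable (f i)) (hh : Measurable h)
    {m : ℝ≥0∞} (hm : m ≠ ∞) (hfm : ∀ i x, f i x ≤ m)
    (hle : ∀ x : ι → ℝ, ∏ i, f i (x i) ^ c i ≤ h (∑ i, c i • x i)) :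
    ∏ i, (∫⁻ x, f i x) ^ c i ≤ ∫⁻ x, h x := by
  set M : ι → ℝ≥0∞ := fun i => ⨆ x, f i x with hM
  have hMtop : ∀ i, M i ≠ ∞ := fun i => ne_top_of_le_ne_top hm (iSup_le (hfm i))
  by_cases hzero : ∃ i, M i = 0
  · obtain ⟨i, hi⟩ := hzero
    have : ∀ x, f i x = 0 := by simpa [hM] using hi
    refine le_trans (le_of_eq ?_) zero_le
    exact Finset.prod_eq_zero (Finset.mem_univ i) (by simp [this, hc i])
  push Not at hzero
  set P : ℝ≥0∞ := ∏ i, M i ^ c i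
  have hP0 : P ≠ 0 := Finset.prod_ne_zero_iff.2 fun i _ => by
    simp [ENNReal.rpow_eq_zero_iff, hzero i, hMtop i]
  have hPtop : P ≠ ∞ := ENNReal.prod_ne_top fun i _ =>
    ENNReal.rpow_ne_top_of_nonneg (hc i).le (hMtop i)
  have hdiv : ∀ z : ι → ℝ≥0∞, ∏ i, (z i / M i) ^ c i = (∏ i, z i ^ c i) / P := fun z => by
    simp_rw [ENNReal.div_rpow_of_nonneg _ _ (hc _).le, div_eq_mul_inv, Finset.prod_mul_distrib]
    congr 1
    exact (ENNReal.prod_inv_distrib fun i _ j _ _ => Or.inl (by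
      simp [ENNReal.rpow_eq_zero_iff, hzero, hMtop])).symm
  have hg1 : ∀ i x, f i x / M i ≤ 1 := fun i x =>
    ENNReal.div_le_of_le_mul (by simpa using le_iSup (f i) x)
  have hgtop : ∀ i x, f i x / M i ≠ ∞ := fun i x => ne_top_of_le_ne_top ENNReal.one_ne_top (hg1 i x)
  have key := sum_lintegral_le_of_prod_le hc hsum (g := fun i x => (f i x / M i).toReal)
    (h := fun x => (min (h x / P) 1).toReal) (fun i => ((hf i).div_const _).ennreal_toReal)
    ((hh.div_const _).min measurable_const).ennreal_toReal
    (fun i x => ENNReal.toReal_nonneg) (fun i x => ENNReal.toReal_le_of_le_ofReal zero_le_one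
      (by simpa using hg1 i x)) ?_ (fun x => ENNReal.toReal_nonneg) ?_
  · simp only [ENNReal.ofReal_toReal (hgtop _ _),
      ENNReal.ofReal_toReal (ne_top_of_le_ne_top ENNReal.one_ne_top (min_le_right _ _))] at key
    have h1 := (ENNReal.geom_mean_le_arith_mean hc hsum
      fun i => ∫⁻ x, f i x / M i).trans key
    have h2 : ∫⁻ x, min (h x / P) 1 ≤ (∫⁻ x, h x) / P := by
      refine (lintegral_mono fun x => min_le_left _ _).trans (le_of_eq ?_)
      simp_rw [div_eq_mul_inv]
      rw [lintegral_mul_const _ hh]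
    have h3 : ∀ i, ∫⁻ x, f i x / M i = (∫⁻ x, f i x) / M i := fun i => by
      simp_rw [div_eq_mul_inv]
      rw [lintegral_mul_const _ (hf i)]
    simp_rw [h3, hdiv] at h1
    have h4 := h1.trans h2
    rwa [ENNReal.div_le_iff hP0 hPtop, ENNReal.div_mul_cancel hP0 hPtop] at h4
  · intro i r hr
    rcases lt_or_ge r 0 with hr0 | hr0
    · exact ⟨0, hr0.trans_le ENNReal.toReal_nonneg⟩
    have : ENNReal.ofReal r * M i < M i := by
      conv_rhs => rw [← one_mul (M i)]
      exact (ENNReal.mul_lt_mul_iff_left (hzero i) (hMtop i)).2 (by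
        rw [ENNReal.ofReal_lt_one]; exact hr)
    obtain ⟨x, hx⟩ := lt_iSup_iff.1 this
    refine ⟨x, ?_⟩
    rw [← ENNReal.ofReal_lt_iff_lt_toReal hr0 (hgtop i x)]
    rwa [ENNReal.lt_div_iff_mul_lt (Or.inl (hzero i)) (Or.inl (hMtop i))]
  · intro x
    have h1 : ∏ i, (f i (x i) / M i) ^ c i ≤ min (h (∑ i, c i • x i) / P) 1 := by
      refine le_min ?_ (Finset.prod_le_one' fun i _ => ENNReal.rpow_le_one (hg1 i _) (hc i).le)
      rw [hdiv]
      gcongr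
      exact hle x
    have h2 := ENNReal.toReal_mono
      (ne_top_of_le_ne_top ENNReal.one_ne_top (min_le_right _ _)) h1
    simpa [ENNReal.toReal_prod, ← ENNReal.toReal_rpow] using h2

protected theorem real (hc : ∀ i, 0 < c i) (hsum : ∑ i, c i = 1) :
    SatisfiesPrekopaLeindler ℝ c := by
  intro f h hf hh hle
  by_cases hzero : ∃ i, ∫⁻ x, f i x = 0
  · obtain ⟨i, hi⟩ := hzero
    refine le_trans (le_of_eq ?_) zero_le
    exact Finset.prod_eq_zero (Finset.mem_univ i) (by simp [hi, hc i])
  push Not at hzero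
  have hlim : ∀ i, Tendsto (fun m : ℕ => ∫⁻ x, min (f i x) m) atTop (𝓝 (∫⁻ x, f i x)) := by
    intro i
    refine lintegral_tendsto_of_tendsto_of_monotone
      (fun m => ((hf i).min measurable_const).aemeasurable) (ae_of_all _ fun x m m' hmm' => ?_)
      (ae_of_all _ fun x => ?_)
    · exact min_le_min le_rfl (by exact_mod_cast hmm')
    · simpa using (tendsto_const_nhds (x := f i x)).min ENNReal.tendsto_nat_nhds_top
  have hprod : ∀ s : Finset ι, Tendsto (fun m : ℕ => ∏ i ∈ s, (∫⁻ x, min (f i x) m) ^ c i) atTop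
      (𝓝 (∏ i ∈ s, (∫⁻ x, f i x) ^ c i)) := by
    classical
    have hne : ∀ i, (∫⁻ x, f i x) ^ c i ≠ 0 := fun i => by
      simp [ENNReal.rpow_eq_zero_iff, hzero i, (hc i).not_gt]
    intro s
    induction s using Finset.induction_on with
    | empty => simp
    | insert a s ha ih =>
      simp only [Finset.prod_insert ha]
      exact ENNReal.Tendsto.mul ((hlim a).ennrpow_const _) (Or.inl (hne a)) ih
        (Or.inl (Finset.prod_ne_zero_iff.2 fun i _ => hne i))
  refine le_of_tendsto' (hprod Finset.univ) fun m => ?_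
  refine of_bounded hc hsum (fun i => (hf i).min measurable_const) hh
    (ENNReal.natCast_ne_top m) (fun i x => min_le_right _ _) fun x => ?_
  refine le_trans (Finset.prod_le_prod' fun i _ => ?_) (hle x)
  exact ENNReal.rpow_le_rpow (min_le_left _ _) (hc i).le

protected theorem prod {E F : Type*} [AddCommMonoid E] [Module ℝ E] [MeasureSpace E]
    [AddCommMonoid F] [Module ℝ F] [MeasureSpace F] [SFinite (volume : Measure F)]
    (hE : SatisfiesPrekopaLeindler E c) (hF : SatisfiesPrekopaLeindler F c) :
    SatisfiesPrekopaLeindler (E × F) c := by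
  intro f h hf hh hle
  have key : ∀ g : E × F → ℝ≥0∞, Measurable g → ∫⁻ z, g z = ∫⁻ x, ∫⁻ y, g (x, y) :=
    fun g hg => lintegral_prod g hg.aemeasurable
  rw [key h hh, Finset.prod_congr rfl fun i _ => by rw [key (f i) (hf i)]]
  refine hE _ _ (fun i => (hf i).lintegral_prod_right') hh.lintegral_prod_right' fun x => ?_
  refine hF (fun i y => f i (x i, y)) (fun y => h (∑ i, c i • x i, y))
    (fun i => (hf i).comp measurable_prodMk_left) (hh.comp measurable_prodMk_left) fun y => ?_
  simpa [prod_mk_sum] using hle fun i => (x i, y i)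

theorem of_measurePreserving {E F : Type*} [AddCommMonoid E] [Module ℝ E] [MeasureSpace E]
    [AddCommMonoid F] [Module ℝ F] [MeasureSpace F] (hF : SatisfiesPrekopaLeindler F c)
    (e : F →ₗ[ℝ] E) (he : MeasurePreserving e) : SatisfiesPrekopaLeindler E c := by
  intro f h hf hh hle
  have := hF (fun i => f i ∘ e) (h ∘ e) (fun i => (hf i).comp he.measurable)
    (hh.comp he.measurable) fun x => by simpa using hle fun i => e (x i)
  simp only [Function.comp_apply] at this
  simpa only [he.lintegral_comp (hf _), he.lintegral_comp hh] using this

theorem pi_fin (hc : ∀ i, 0 < c i) (hsum : ∑ i, c i = 1) (n : ℕ) :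
    SatisfiesPrekopaLeindler (Fin n → ℝ) c := by
  induction n with
  | zero =>
    intro f h hf hh hle
    have key : ∀ g : (Fin 0 → ℝ) → ℝ≥0∞, ∫⁻ x, g x = g 0 := fun g => by
      rw [Measure.volume_pi_eq_dirac (0 : Fin 0 → ℝ), lintegral_dirac]
    rw [key h, Finset.prod_congr rfl fun i _ => by rw [key (f i)]]
    simpa using hle fun _ => 0
  | succ n ih =>
    let e : ℝ × (Fin n → ℝ) →ₗ[ℝ] (Fin (n + 1) → ℝ) :=
      { toFun := (MeasurableEquiv.piFinSuccAbove (fun _ => ℝ) 0).symm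
        map_add' := fun x y => by
          ext j; refine Fin.cases ?_ (fun j => ?_) j <;> simp [MeasurableEquiv.piFinSuccAbove]
        map_smul' := fun r x => by
          ext j; refine Fin.cases ?_ (fun j => ?_) j <;> simp [MeasurableEquiv.piFinSuccAbove] }
    exact ((SatisfiesPrekopaLeindler.real hc hsum).prod ih).of_measurePreserving e
      ((volume_preserving_piFinSuccAbove (fun _ => ℝ) 0).symm _)

theorem euclideanSpace (hc : ∀ i, 0 < c i) (hsum : ∑ i, c i = 1) (n : ℕ) :
    SatisfiesPrekopaLeindler (EuclideanSpace ℝ (Fin n)) c :=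
  (pi_fin hc hsum n).of_measurePreserving (WithLp.linearEquiv 2 ℝ (Fin n → ℝ)).symm.toLinearMap
    (PiLp.volume_preserving_toLp (Fin n))

end SatisfiesPrekopaLeindler

section Quantile

/-- A continuous positive probability density on `ℝ` has a differentiable quantile function. -/
theorem exists_cdf_quantile {G : ℝ → ℝ} (hG : Continuous G) (hpos : ∀ x, 0 < G x)
    (hint : Integrable G) (hone : ∫ x, G x = 1) :
    ∃ Φ Q : ℝ → ℝ, (∀ x, Φ x ∈ Ioo (0 : ℝ) 1) ∧ (∀ x, Q (Φ x) = x) ∧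
      ∀ s ∈ Ioo (0 : ℝ) 1, HasDerivAt Q (G (Q s))⁻¹ s := by
  set Φ : ℝ → ℝ := fun t => ∫ x in Iic t, G x with hΦ
  have hΦ_eq : ∀ t, Φ t = Φ 0 + ∫ x in (0 : ℝ)..t, G x := fun t => by
    rw [← intervalIntegral.integral_Iic_sub_Iic hint.integrableOn hint.integrableOn]
    simp [hΦ]
  have hderiv : ∀ t, HasDerivAt Φ (G t) t := fun t => by
    rw [funext hΦ_eq]
    exact (intervalIntegral.integral_hasDerivAt_right (hG.intervalIntegrable _ _)
      (hG.stronglyMeasurableAtFilter _ _) hG.continuousAt).const_add _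
  have hmono : StrictMono Φ := strictMono_of_deriv_pos fun t => by
    rw [(hderiv t).deriv]; exact hpos t
  have hcont : Continuous Φ := continuous_iff_continuousAt.2 fun t => (hderiv t).continuousAt
  have htop : Tendsto Φ atTop (𝓝 1) := by
    have h := (intervalIntegral_tendsto_integral_Ioi 0 hint.integrableOn tendsto_id).const_add (Φ 0)
    rw [intervalIntegral.integral_Iic_add_Ioi hint.integrableOn hint.integrableOn, hone] at h
    exact h.congr fun t => (hΦ_eq t).symm
  have hbot : Tendsto Φ atBot (𝓝 0) := by
    have h := (intervalIntegral_tendsto_integral_Iic 0 hint.integrableOn tendsto_id).const_sub (Φ 0)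
    rw [show ∫ x in Iic (0 : ℝ), G x = Φ 0 from rfl, sub_self] at h
    refine h.congr fun t => ?_
    rw [hΦ_eq t, intervalIntegral.integral_symm]
    simp
  have hmem : ∀ x, Φ x ∈ Ioo (0 : ℝ) 1 := fun x =>
    ⟨(hmono.monotone.le_of_tendsto hbot (x - 1)).trans_lt (hmono (by linarith)),
      (hmono (by linarith : x < x + 1)).trans_le (hmono.monotone.ge_of_tendsto htop (x + 1))⟩
  have hsurj : ∀ s ∈ Ioo (0 : ℝ) 1, ∃ x, Φ x = s := fun s hs =>
    mem_range_of_exists_le_of_exists_ge hcont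
      ((hbot.eventually (gt_mem_nhds hs.1)).exists.imp fun _ h => h.le)
      ((htop.eventually (lt_mem_nhds hs.2)).exists.imp fun _ h => h.le)
  choose! Q hQ using hsurj
  refine ⟨Φ, Q, hmem, fun x => hmono.injective (hQ _ (hmem x)), fun s hs => ?_⟩
  have hev : ∀ᶠ s' in 𝓝 s, Φ (Q s') = s' := by
    filter_upwards [isOpen_Ioo.mem_nhds hs] with s' hs' using hQ s' hs'
  refine HasDerivAt.of_local_left_inverse ?_ (hderiv (Q s)) (hpos _).ne' hev
  refine tendsto_order.2 ⟨fun a ha => ?_, fun a ha => ?_⟩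
  · have : Φ a < s := by rw [← hQ s hs]; exact hmono ha
    filter_upwards [hev, lt_mem_nhds this] with s' h1 h2
    rw [← h1] at h2
    exact hmono.lt_iff_lt.1 h2
  · have : s < Φ a := by rw [← hQ s hs]; exact hmono ha
    filter_upwards [hev, gt_mem_nhds this] with s' h1 h2
    rw [← h1] at h2
    exact hmono.lt_iff_lt.1 h2

variable {ι : Type*} [Fintype ι]

/-- Equality in the one-dimensional Prékopa–Leindler inequality for continuous positive
densities forces the densities to be translates of each other. -/
theorem exists_translate_of_prod_le {c : ι → ℝ} (hc : ∀ i, 0 < c i)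
    (hsum : ∑ i, c i = 1) {G : ι → ℝ → ℝ} {H : ℝ → ℝ≥0∞} (hG : ∀ i, Continuous (G i))
    (hpos : ∀ i x, 0 < G i x) (hint : ∀ i, Integrable (G i)) (hone : ∀ i, ∫ x, G i x = 1)
    (hH : ∫⁻ x, H x ≤ 1)
    (hle : ∀ x : ι → ℝ, ENNReal.ofReal (∏ i, G i (x i) ^ c i) ≤ H (∑ i, c i • x i)) (i j : ι) :
    ∃ w, ∀ x, G i (x + w) = G j x := by
  choose Φ Q hΦ hQΦ hQ using fun i => exists_cdf_quantile (hG i) (hpos i) (hint i) (hone i)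
  have hne : (Finset.univ : Finset ι).Nonempty := ⟨i, Finset.mem_univ i⟩
  have hX : ∀ s ∈ Ioo (0 : ℝ) 1, HasDerivAt (fun s => ∑ i, c i • Q i s)
      (∑ i, c i * (G i (Q i s))⁻¹) s := fun s hs => by
    simpa using HasDerivAt.fun_sum fun i (_ : i ∈ Finset.univ) => (hQ i s hs).const_mul (c i)
  have hX'pos : ∀ s, 0 < ∑ i, c i * (G i (Q i s))⁻¹ := fun s =>
    Finset.sum_pos (fun i _ => mul_pos (hc i) (inv_pos.2 (hpos i _))) hne
  have hXinj : InjOn (fun s => ∑ i, c i • Q i s) (Ioo (0 : ℝ) 1) := by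
    refine StrictMonoOn.injOn (strictMonoOn_of_deriv_pos (convex_Ioo 0 1)
      (fun s hs => (hX s hs).continuousAt.continuousWithinAt) fun s hs => ?_)
    rw [interior_Ioo] at hs
    rw [(hX s hs).deriv]
    exact hX'pos s
  have hQcont : ∀ i, ContinuousOn (Q i) (Ioo 0 1) := fun i s hs =>
    (hQ i s hs).continuousAt.continuousWithinAt
  have hgcont : ∀ i, ContinuousOn (fun s => G i (Q i s)) (Ioo 0 1) := fun i =>
    (hG i).comp_continuousOn (hQcont i)
  set L : ℝ → ℝ := fun s =>
    (∑ i, c i * (G i (Q i s))⁻¹) * ∏ i, G i (Q i s) ^ c i with hL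
  have hLcont : ContinuousOn L (Ioo 0 1) :=
    (continuousOn_finsetSum _ fun i _ => continuousOn_const.mul
      ((hgcont i).inv₀ fun s _ => (hpos i _).ne')).mul
    (continuousOn_finsetProd _ fun i _ => (hgcont i).rpow_const fun s _ => Or.inl (hpos i _).ne')
  have hprodpos : ∀ s, 0 < ∏ i, G i (Q i s) ^ c i := fun s =>
    Finset.prod_pos fun i _ => Real.rpow_pos_of_pos (hpos i _) _
  have hinv : ∀ s, ∏ i, (G i (Q i s))⁻¹ ^ c i = (∏ i, G i (Q i s) ^ c i)⁻¹ := fun s => by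
    rw [← Finset.prod_inv_distrib]
    exact Finset.prod_congr rfl fun i _ => Real.inv_rpow (hpos i _).le _
  have hL1 : ∀ s, 1 ≤ L s := fun s => by
    have := Real.geom_mean_le_arith_mean_weighted Finset.univ c (fun i => (G i (Q i s))⁻¹)
      (fun i _ => (hc i).le) hsum (fun i _ => (inv_pos.2 (hpos i _)).le)
    rw [hinv, inv_le_iff_one_le_mul₀ (hprodpos s)] at this
    exact this
  have hLint : ∫⁻ s in Ioo (0 : ℝ) 1, ENNReal.ofReal (L s) ≤ 1 := by
    refine le_trans ?_ ((setLIntegral_le_lintegral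
      ((fun s => ∑ i, c i • Q i s) '' Ioo (0 : ℝ) 1) _).trans hH)
    rw [lintegral_image_eq_lintegral_abs_deriv_mul measurableSet_Ioo
      (fun s hs => (hX s hs).hasDerivWithinAt) hXinj]
    refine lintegral_mono fun s => ?_
    simp only [hL]
    rw [abs_of_pos (hX'pos s), ENNReal.ofReal_mul (hX'pos s).le]
    gcongr
    exact hle fun i => Q i s
  have hae : (fun _ => 1) =ᵐ[volume.restrict (Ioo (0 : ℝ) 1)] fun s => ENNReal.ofReal (L s) := by
    refine ae_eq_of_ae_le_of_lintegral_le (ae_of_all _ fun s => ?_) (by simp) ?_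
      (by simpa using hLint)
    · simpa using hL1 s
    · exact (hLcont.aemeasurable measurableSet_Ioo).ennreal_ofReal
  have hLeq : EqOn L (fun _ => 1) (Ioo 0 1) := by
    refine Measure.eqOn_open_of_ae_eq (μ := volume) ?_ isOpen_Ioo hLcont continuousOn_const
    filter_upwards [hae] with s hs
    exact (ENNReal.ofReal_eq_one.1 hs.symm)
  have hGeq : ∀ s ∈ Ioo (0 : ℝ) 1, ∀ i j, G i (Q i s) = G j (Q j s) := fun s hs i j => by
    have := (Real.geom_mean_eq_arith_mean_weighted_iff_of_pos' Finset.univ c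
      (fun i => (G i (Q i s))⁻¹) (fun i _ => hc i) hsum
      (fun i _ => (inv_pos.2 (hpos i _)).le)).1 (by
        rw [hinv, inv_eq_iff_eq_inv, ← one_div, eq_div_iff (hX'pos s).ne', mul_comm]
        exact hLeq hs)
    exact inv_injective ((this i (Finset.mem_univ i)).trans (this j (Finset.mem_univ j)).symm)
  have hhalf : (1 / 2 : ℝ) ∈ Ioo (0 : ℝ) 1 := by norm_num
  refine ⟨Q i (1 / 2) - Q j (1 / 2), fun x => ?_⟩
  have hconst : Q i (Φ j x) - Q j (Φ j x) = Q i (1 / 2) - Q j (1 / 2) := by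
    have hd : ∀ s ∈ Ioo (0 : ℝ) 1, HasDerivAt (fun s => Q i s - Q j s) 0 s := fun s hs => by
      have := (hQ i s hs).fun_sub (hQ j s hs)
      rwa [hGeq s hs i j, sub_self] at this
    exact isOpen_Ioo.is_const_of_deriv_eq_zero isPreconnected_Ioo
      (fun s hs => (hd s hs).differentiableAt.differentiableWithinAt)
      (fun s hs => (hd s hs).deriv) (hΦ j x) hhalf
  have := hGeq _ (hΦ j x) i j
  rw [hQΦ] at this hconst
  rw [← this, ← hconst]
  congr 1
  ring

end Quantile

section LogConcave

variable {V : Type*} [AddCommGroup V] [Module ℝ V]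

theorem eq_Icc_of_isClosed_of_combination_mem {S : Set ℝ} (hS : IsClosed S) (h0 : (0 : ℝ) ∈ S)
    (h1 : (1 : ℝ) ∈ S) {r : ℝ} (hr0 : 0 < r) (hr1 : r < 1)
    (hcomb : ∀ a ∈ S, ∀ b ∈ S, (1 - r) * a + r * b ∈ S) : Icc (0 : ℝ) 1 ⊆ S := by
  intro t ht
  by_contra htS
  have hA : IsCompact (S ∩ Icc 0 t) := isCompact_Icc.inter_left hS
  have hB : IsCompact (S ∩ Icc t 1) := isCompact_Icc.inter_left hS
  have ha := hA.sSup_mem ⟨0, h0, le_rfl, ht.1⟩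
  have hb := hB.sInf_mem ⟨1, h1, ht.2, le_rfl⟩
  set a := sSup (S ∩ Icc 0 t)
  set b := sInf (S ∩ Icc t 1)
  have hat : a < t := lt_of_le_of_ne ha.2.2 fun h => htS (h ▸ ha.1)
  have htb : t < b := lt_of_le_of_ne hb.2.1 fun h => htS (h ▸ hb.1)
  have hm := hcomb a ha.1 b hb.1
  have ham : a < (1 - r) * a + r * b := by nlinarith
  have hmb : (1 - r) * a + r * b < b := by nlinarith
  rcases le_total ((1 - r) * a + r * b) t with h | h
  · exact absurd (le_csSup hA.bddAbove ⟨hm, ha.2.1.trans ham.le, h⟩) (not_le.2 ham)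
  · exact absurd (csInf_le hB.bddBelow ⟨hm, h, hmb.le.trans hb.2.2⟩) (not_le.2 hmb)

theorem isLogConcave_of_continuous [TopologicalSpace V] [IsTopologicalAddGroup V]
    [ContinuousSMul ℝ V] {φ : V → ℝ} (hφ : Continuous φ) (hφ0 : ∀ x, 0 ≤ φ x) {r : ℝ}
    (hr0 : 0 < r) (hr1 : r < 1)
    (h : ∀ x y, φ x ^ (1 - r) * φ y ^ r ≤ φ ((1 - r) • x + r • y)) : IsLogConcave φ := by
  set S : Set ℝ := {t | ∀ x y, 0 < φ x → 0 < φ y →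
    φ x ^ (1 - t) * φ y ^ t ≤ φ ((1 - t) • x + t • y)} with hSdef
  have hS : IsClosed S := by
    simp only [hSdef, ofPred_forall]
    refine isClosed_iInter fun x => isClosed_iInter fun y => isClosed_iInter fun hx =>
      isClosed_iInter fun hy => isClosed_le ?_ (by fun_prop)
    exact (continuous_const.rpow (by fun_prop) fun _ => Or.inl hx.ne').mul
      (continuous_const.rpow continuous_id fun _ => Or.inl hy.ne')
  have hcomb : ∀ a ∈ S, ∀ b ∈ S, (1 - r) * a + r * b ∈ S := by
    intro a ha b hb x y hx hy
    refine le_trans ?_ ((h ((1 - a) • x + a • y) ((1 - b) • x + b • y)).trans (le_of_eq ?_))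
    · refine le_trans (le_of_eq ?_) (mul_le_mul
        (Real.rpow_le_rpow (by positivity) (ha x y hx hy) (sub_pos.2 hr1).le)
        (Real.rpow_le_rpow (by positivity) (hb x y hx hy) hr0.le)
        (by positivity) (Real.rpow_nonneg (hφ0 _) _))
      rw [Real.mul_rpow (by positivity) (by positivity),
        Real.mul_rpow (by positivity) (by positivity), ← Real.rpow_mul hx.le,
        ← Real.rpow_mul hx.le, ← Real.rpow_mul hy.le, ← Real.rpow_mul hy.le,
        mul_mul_mul_comm, ← Real.rpow_add hx, ← Real.rpow_add hy]
      congr 2 <;> ring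
    · congr 1
      module
  intro x y t ht0 ht1
  rcases (hφ0 x).eq_or_lt with hx | hx
  · rw [← hx, Real.zero_rpow (sub_pos.2 ht1).ne', zero_mul]; exact hφ0 _
  rcases (hφ0 y).eq_or_lt with hy | hy
  · rw [← hy, Real.zero_rpow ht0.ne', mul_zero]; exact hφ0 _
  exact eq_Icc_of_isClosed_of_combination_mem hS (fun x y _ _ => by simp)
    (fun x y _ _ => by simp) hr0 hr1 hcomb ⟨ht0.le, ht1.le⟩ x y hx hy

theorem isLogConcave_of_prod_le [TopologicalSpace V] [IsTopologicalAddGroup V]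
    [ContinuousSMul ℝ V] {ι : Type*} [Fintype ι] [Nontrivial ι] {c : ι → ℝ} (hc : ∀ i, 0 < c i)
    (hsum : ∑ i, c i = 1) {φ : V → ℝ} (hφ : Continuous φ) (hφ0 : ∀ x, 0 ≤ φ x)
    (h : ∀ z : ι → V, ∏ i, φ (z i) ^ c i ≤ φ (∑ i, c i • z i)) : IsLogConcave φ := by
  classical
  obtain ⟨i, j, hij⟩ := exists_pair_ne ι
  have hrest : ∑ l ∈ Finset.univ.erase i, c l = 1 - c i := by
    rw [← hsum, ← Finset.add_sum_erase _ _ (Finset.mem_univ i)]; ring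
  have hrestpos : 0 < ∑ l ∈ Finset.univ.erase i, c l :=
    Finset.sum_pos (fun l _ => hc l) ⟨j, by simp [hij.symm]⟩
  refine isLogConcave_of_continuous hφ hφ0 (hc i) (by linarith) fun x y => ?_
  have key := h (Function.update (fun _ => x) i y)
  rw [← Finset.mul_prod_erase _ _ (Finset.mem_univ i),
    ← Finset.add_sum_erase _ _ (Finset.mem_univ i)] at key
  rw [Finset.prod_congr rfl (g := fun l => φ x ^ c l) fun l hl => by
      rw [Function.update_of_ne (Finset.ne_of_mem_erase hl)],
    Finset.sum_congr rfl (g := fun l => c l • x) fun l hl => by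
      rw [Function.update_of_ne (Finset.ne_of_mem_erase hl)],
    ← Real.rpow_sum_of_nonneg (hφ0 x) fun l _ => (hc l).le, ← Finset.sum_smul, hrest] at key
  simpa [mul_comm, add_comm] using key

theorem IsLogConcave.integrableOn_Ioi_id_mul {G : ℝ → ℝ} (hG : IsLogConcave G)
    (hcont : Continuous G) (hpos : ∀ x, 0 < G x) (hint : Integrable G) :
    IntegrableOn (fun x => x * G x) (Ioi 0) := by
  obtain ⟨x₁, hx₁, hlt⟩ : ∃ x₁, 0 < x₁ ∧ G x₁ < G 0 := by
    by_contra! hcon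
    have h1 : IntegrableOn (fun _ : ℝ => G 0) (Ioi 0) := by
      refine (hint.integrableOn (s := Ioi 0)).mono' (by fun_prop) ?_
      filter_upwards [ae_restrict_mem measurableSet_Ioi] with x hx
      rw [Real.norm_of_nonneg (hpos 0).le]
      exact hcon x hx
    simp [integrableOn_const_iff, (hpos 0).ne'] at h1
  set b := (Real.log (G 0) - Real.log (G x₁)) / x₁
  have hb : 0 < b := div_pos (sub_pos.2 (Real.log_lt_log (hpos _) hlt)) hx₁
  have hbound : ∀ x, x₁ < x → G x ≤ G 0 * Real.exp (-b * x) := by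
    intro x hx
    have hx0 : 0 < x := hx₁.trans hx
    have h := Real.log_le_log (by have := hpos 0; have := hpos x; positivity)
      (hG 0 x (x₁ / x) (div_pos hx₁ hx0) ((div_lt_one hx0).2 hx))
    rw [Real.log_mul (Real.rpow_pos_of_pos (hpos _) _).ne' (Real.rpow_pos_of_pos (hpos _) _).ne',
      Real.log_rpow (hpos _), Real.log_rpow (hpos _)] at h
    have he : (1 - x₁ / x) • (0 : ℝ) + (x₁ / x) • x = x₁ := by
      simp only [smul_eq_mul]; field_simp; ring
    rw [he] at h
    rw [← Real.log_le_log_iff (hpos x) (mul_pos (hpos 0) (Real.exp_pos _)),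
      Real.log_mul (hpos 0).ne' (Real.exp_pos _).ne', Real.log_exp]
    have hbx : b * x₁ = Real.log (G 0) - Real.log (G x₁) := div_mul_cancel₀ _ hx₁.ne'
    have h2 : x₁ / x * (Real.log (G x) - Real.log (G 0) + b * x) ≤ 0 := by
      have : x₁ / x * (b * x) = b * x₁ := by field_simp
      linarith
    have h3 := (mul_nonpos_iff_pos_imp_nonpos.1 h2).1 (div_pos hx₁ hx0)
    linarith
  refine integrable_of_isBigO_exp_neg (half_pos hb) (by fun_prop) ?_
  have h1 : G =O[atTop] fun x => Real.exp (-b * x) := by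
    refine Asymptotics.IsBigO.of_bound (G 0) ?_
    filter_upwards [eventually_gt_atTop x₁] with x hx
    rw [Real.norm_of_nonneg (hpos x).le, Real.norm_of_nonneg (Real.exp_pos _).le]
    exact hbound x hx
  have h2 := (isLittleO_pow_exp_pos_mul_atTop 1 (half_pos hb)).isBigO.mul h1
  refine (h2.congr_left fun x => by simp).congr_right fun x => ?_
  rw [← Real.exp_add]
  congr 1
  ring

theorem IsLogConcave.integrable_id_mul {G : ℝ → ℝ} (hG : IsLogConcave G)
    (hcont : Continuous G) (hpos : ∀ x, 0 < G x) (hint : Integrable G) :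
    Integrable fun x => x * G x := by
  have h1 := hG.integrableOn_Ioi_id_mul hcont hpos hint
  have hneg : IsLogConcave fun x => G (-x) := fun x y t ht0 ht1 => by
    have := hG (-x) (-y) t ht0 ht1
    convert this using 2
    simp only [smul_eq_mul]; ring
  have h2 := hneg.integrableOn_Ioi_id_mul (by fun_prop) (fun x => hpos _) hint.comp_neg
  rw [← integrableOn_univ, ← Iic_union_Ioi (a := (0 : ℝ))]
  refine IntegrableOn.union ?_ h1
  rw [integrableOn_Iic_iff_integrableOn_Iio]
  rw [← (Measure.measurePreserving_neg volume).integrableOn_comp_preimage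
    (Homeomorph.neg ℝ).measurableEmbedding, neg_preimage, neg_Iio, neg_zero]
  exact h2.neg.congr_fun (fun x _ => by simp) measurableSet_Ioi

end LogConcave

section GaussianSmoothing

open ProbabilityTheory

/-- The density of the convolution of `ρ` with the standard Gaussian measure. -/
noncomputable def gaussianSmoothing (ρ : Measure ℝ) (t : ℝ) : ℝ :=
  ∫ y, gaussianPDFReal 0 1 (t - y) ∂ρ

theorem continuous_gaussianPDFReal (m : ℝ) (v : NNReal) : Continuous (gaussianPDFReal m v) := by
  unfold gaussianPDFReal
  fun_prop

theorem gaussianPDFReal_le (m : ℝ) (v : NNReal) (x : ℝ) :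
    gaussianPDFReal m v x ≤ (√(2 * Real.pi * v))⁻¹ := by
  refine mul_le_of_le_one_right (by positivity) (Real.exp_le_one_iff.2 ?_)
  exact div_nonpos_of_nonpos_of_nonneg (neg_nonpos.2 (sq_nonneg _)) (by positivity)

variable {ι : Type*} [Fintype ι]

theorem prod_gaussianPDFReal_rpow_le {c : ι → ℝ} (hc : ∀ i, 0 < c i) (hsum : ∑ i, c i = 1)
    (s : ι → ℝ) :
    ∏ i, gaussianPDFReal 0 1 (s i) ^ c i ≤ gaussianPDFReal 0 1 (∑ i, c i * s i) := by
  have hjensen : (∑ i, c i * s i) ^ 2 ≤ ∑ i, c i * s i ^ 2 := by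
    simpa using (even_two.convexOn_pow (𝕜 := ℝ)).map_sum_le (fun i _ => (hc i).le) hsum
      (fun i _ => mem_univ (s i))
  have hfac : ∀ i, gaussianPDFReal 0 1 (s i) ^ c i =
      (√(2 * Real.pi))⁻¹ ^ c i * Real.exp (-(c i * s i ^ 2) / 2) := fun i => by
    simp only [gaussianPDFReal, NNReal.coe_one, mul_one, sub_zero]
    rw [Real.mul_rpow (by positivity) (Real.exp_pos _).le, ← Real.exp_mul]
    congr 2
    ring
  simp only [hfac]
  rw [Finset.prod_mul_distrib, ← Real.rpow_sum_of_pos (by positivity), hsum, Real.rpow_one,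
    ← Real.exp_sum]
  simp only [gaussianPDFReal, NNReal.coe_one, mul_one, sub_zero]
  gcongr
  rw [← Finset.sum_div, Finset.sum_neg_distrib]
  gcongr

section Measure

variable (ρ : Measure ℝ) [IsProbabilityMeasure ρ]

theorem integrable_gaussianPDFReal_sub (t : ℝ) :
    Integrable (fun y => gaussianPDFReal 0 1 (t - y)) ρ := by
  refine Integrable.of_bound
    ((continuous_gaussianPDFReal 0 1).comp (by fun_prop)).aestronglyMeasurable
    (√(2 * Real.pi * (1 : NNReal)))⁻¹ (ae_of_all _ fun y => ?_)
  rw [Real.norm_of_nonneg (gaussianPDFReal_nonneg _ _ _)]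
  exact gaussianPDFReal_le _ _ _

theorem continuous_gaussianSmoothing : Continuous (gaussianSmoothing ρ) := by
  refine continuous_of_dominated (bound := fun _ => (√(2 * Real.pi * (1 : NNReal)))⁻¹)
    (fun t => (integrable_gaussianPDFReal_sub ρ t).aestronglyMeasurable)
    (fun t => ae_of_all _ fun y => ?_) (integrable_const _)
    (ae_of_all _ fun y => (continuous_gaussianPDFReal 0 1).comp (by fun_prop))
  rw [Real.norm_of_nonneg (gaussianPDFReal_nonneg _ _ _)]
  exact gaussianPDFReal_le _ _ _

theorem gaussianSmoothing_pos (t : ℝ) : 0 < gaussianSmoothing ρ t := by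
  refine (integral_pos_iff_support_of_nonneg (fun y => gaussianPDFReal_nonneg _ _ _)
    (integrable_gaussianPDFReal_sub ρ t)).2 ?_
  rw [show Function.support (fun y => gaussianPDFReal 0 1 (t - y)) = univ from
    eq_univ_of_forall fun y => (gaussianPDFReal_pos 0 1 _ one_ne_zero).ne', measure_univ]
  exact one_pos

theorem ofReal_gaussianSmoothing (t : ℝ) :
    ENNReal.ofReal (gaussianSmoothing ρ t) = ∫⁻ y, gaussianPDF 0 1 (t - y) ∂ρ :=
  ofReal_integral_eq_lintegral_ofReal (integrable_gaussianPDFReal_sub ρ t)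
    (ae_of_all _ fun _ => gaussianPDFReal_nonneg _ _ _)

theorem conv_gaussianReal_eq_withDensity :
    ρ ∗ gaussianReal 0 1 =
      volume.withDensity fun t => ENNReal.ofReal (gaussianSmoothing ρ t) := by
  refine Measure.ext_of_lintegral _ fun φ hφ => ?_
  have hpdf := measurable_gaussianPDF 0 1
  rw [Measure.lintegral_conv hφ, lintegral_withDensity_eq_lintegral_mul _
    (continuous_gaussianSmoothing ρ).measurable.ennreal_ofReal hφ,
    gaussianReal_of_var_ne_zero _ one_ne_zero]
  simp only [Pi.mul_apply, ofReal_gaussianSmoothing]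
  calc ∫⁻ y, ∫⁻ z, φ (y + z) ∂(volume.withDensity (gaussianPDF 0 1)) ∂ρ
      = ∫⁻ y, (∫⁻ t, gaussianPDF 0 1 (t - y) * φ t) ∂ρ := by
        refine lintegral_congr fun y => ?_
        rw [lintegral_withDensity_eq_lintegral_mul _ hpdf (by fun_prop),
          ← lintegral_sub_right_eq_self _ y]
        simp
    _ = ∫⁻ t, (∫⁻ y, gaussianPDF 0 1 (t - y) * φ t ∂ρ) := by
        refine lintegral_lintegral_swap (Measurable.aemeasurable ?_)
        exact (hpdf.comp (by fun_prop)).mul (by fun_prop)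
    _ = _ := by
        refine lintegral_congr fun t => lintegral_mul_const _ (hpdf.comp (by fun_prop))

theorem lintegral_gaussianSmoothing : ∫⁻ t, ENNReal.ofReal (gaussianSmoothing ρ t) = 1 := by
  have := congrArg (fun m => m univ) (conv_gaussianReal_eq_withDensity ρ)
  rwa [measure_univ, withDensity_apply _ MeasurableSet.univ, setLIntegral_univ, eq_comm] at this

theorem integrable_gaussianSmoothing : Integrable (gaussianSmoothing ρ) := by
  refine (lintegral_ofReal_ne_top_iff_integrable
    (continuous_gaussianSmoothing ρ).aestronglyMeasurable
    (ae_of_all _ fun t => (gaussianSmoothing_pos ρ t).le)).1 ?_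
  simp [lintegral_gaussianSmoothing]

theorem integral_gaussianSmoothing : ∫ t, gaussianSmoothing ρ t = 1 := by
  rw [integral_eq_lintegral_of_nonneg_ae
    (ae_of_all _ fun t => (gaussianSmoothing_pos ρ t).le)
    (continuous_gaussianSmoothing ρ).aestronglyMeasurable, lintegral_gaussianSmoothing]
  rfl

theorem integrable_id_of_integrable_id_mul_gaussianSmoothing
    (h : Integrable fun t => t * gaussianSmoothing ρ t) : Integrable id ρ := by
  have h1 : Integrable id (ρ ∗ gaussianReal 0 1) := by
    rw [conv_gaussianReal_eq_withDensity, integrable_withDensity_iff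
      (continuous_gaussianSmoothing ρ).measurable.ennreal_ofReal (ae_of_all _ fun _ => by simp)]
    simpa [(gaussianSmoothing_pos ρ _).le] using h
  rw [Measure.conv, integrable_map_measure (by fun_prop) (by fun_prop)] at h1
  have h2 : Integrable (fun p : ℝ × ℝ => p.2) (ρ.prod (gaussianReal 0 1)) := by
    have : Integrable id (gaussianReal 0 1) := (memLp_id_gaussianReal 1).integrable (by simp)
    exact this.comp_snd ρ
  refine (measurePreserving_fst (μ := ρ) (ν := gaussianReal 0 1)).integrable_comp
    (g := id) (by fun_prop) |>.1 ?_
  refine (h1.sub h2).congr (ae_of_all _ fun p => ?_)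
  simp

end Measure

theorem map_add_const_eq_of_gaussianSmoothing {ρ₁ ρ₂ : Measure ℝ} [IsProbabilityMeasure ρ₁]
    [IsProbabilityMeasure ρ₂] {w : ℝ}
    (h : ∀ x, gaussianSmoothing ρ₁ (x + w) = gaussianSmoothing ρ₂ x) :
    ρ₂.map (· + w) = ρ₁ := by
  have hconv : (ρ₂ ∗ gaussianReal 0 1).map (· + w) = ρ₁ ∗ gaussianReal 0 1 := by
    simp only [conv_gaussianReal_eq_withDensity]
    refine Measure.ext_of_lintegral _ fun φ hφ => ?_
    have hm₁ := (continuous_gaussianSmoothing ρ₁).measurable.ennreal_ofReal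
    have hm₂ := (continuous_gaussianSmoothing ρ₂).measurable.ennreal_ofReal
    rw [lintegral_map hφ (by fun_prop), lintegral_withDensity_eq_lintegral_mul _ hm₁ hφ,
      lintegral_withDensity_eq_lintegral_mul _ hm₂ (by fun_prop),
      ← lintegral_add_right_eq_self (_ * φ) w]
    simp [h]
  have : IsProbabilityMeasure (ρ₂.map (· + w)) :=
    Measure.isProbabilityMeasure_map (by fun_prop)
  refine Measure.ext_of_charFun (funext fun t => ?_)
  have := congrArg (fun m => charFun m t) hconv
  rw [charFun_map_add_const, charFun_conv, charFun_conv, mul_right_comm] at this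
  rw [charFun_map_add_const]
  refine mul_right_cancel₀ ?_ this
  rw [charFun_gaussianReal]
  exact Complex.exp_ne_zero _

/-- If the Gaussian smoothings of probability measures achieve equality in the Prékopa–Leindler
inequality, then the measures have finite means and are translates of each other. -/
theorem integrable_id_and_map_eq_of_gaussianSmoothing [Nontrivial ι] {c : ι → ℝ}
    (hc : ∀ i, 0 < c i) (hsum : ∑ i, c i = 1) {ρ : ι → Measure ℝ}
    [∀ i, IsProbabilityMeasure (ρ i)] {η : Measure ℝ} [IsProbabilityMeasure η]
    (hle : ∀ t : ι → ℝ,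
      ∏ i, gaussianSmoothing (ρ i) (t i) ^ c i ≤ gaussianSmoothing η (∑ i, c i • t i)) :
    (∀ i, Integrable id (ρ i)) ∧
      ∀ i j, (ρ j).map (· + ((∫ x, x ∂(ρ i)) - ∫ x, x ∂(ρ j))) = ρ i := by
  have htrans : ∀ i j, ∃ w, ∀ x,
      gaussianSmoothing (ρ i) (x + w) = gaussianSmoothing (ρ j) x := fun i j =>
    exists_translate_of_prod_le hc hsum (H := fun x => ENNReal.ofReal (gaussianSmoothing η x))
      (fun i => continuous_gaussianSmoothing (ρ i)) (fun i => gaussianSmoothing_pos (ρ i))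
      (fun i => integrable_gaussianSmoothing (ρ i)) (fun i => integral_gaussianSmoothing (ρ i))
      (lintegral_gaussianSmoothing η).le (fun t => ENNReal.ofReal_le_ofReal (hle t)) i j
  choose w hw using htrans
  have hint : ∀ i, Integrable id (ρ i) := fun i => by
    set G := gaussianSmoothing (ρ i)
    set W := ∑ j, c j • w j i
    have hG := continuous_gaussianSmoothing (ρ i)
    have hη := continuous_gaussianSmoothing η
    have hGpos := gaussianSmoothing_pos (ρ i)
    have hprod : ∀ z : ι → ℝ,
        ∏ j, G (z j) ^ c j ≤ gaussianSmoothing η (∑ j, c j • z j + W) := fun z => by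
      have := hle fun j => z j + w j i
      simpa only [hw, smul_add, Finset.sum_add_distrib] using this
    have hGle : ∀ z, G z ≤ gaussianSmoothing η (z + W) := fun z => by
      have := hprod fun _ => z
      rwa [← Real.rpow_sum_of_pos (hGpos z), hsum, Real.rpow_one, ← Finset.sum_smul, hsum,
        one_smul] at this
    have hGeq : (fun z => gaussianSmoothing η (z + W)) = G := by
      refine Continuous.ae_eq_iff_eq volume (by fun_prop) hG |>.1 ?_
      have := ae_eq_of_ae_le_of_lintegral_le (μ := volume)
        (f := fun z => ENNReal.ofReal (G z))
        (g := fun z => ENNReal.ofReal (gaussianSmoothing η (z + W)))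
        (ae_of_all _ fun z => ENNReal.ofReal_le_ofReal (hGle z))
        (by simp [G, lintegral_gaussianSmoothing]) (by fun_prop)
        (by
          rw [lintegral_add_right_eq_self (fun z => ENNReal.ofReal (gaussianSmoothing η z)) W,
            lintegral_gaussianSmoothing, lintegral_gaussianSmoothing])
      filter_upwards [this] with z hz
      exact ((ENNReal.ofReal_eq_ofReal_iff (hGpos _).le (gaussianSmoothing_pos η _).le).1 hz).symm
    have hlc : IsLogConcave G := isLogConcave_of_prod_le hc hsum hG (fun x => (hGpos x).le)
      fun z => (hprod z).trans_eq (congr_fun hGeq _)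
    exact integrable_id_of_integrable_id_mul_gaussianSmoothing _
      (hlc.integrable_id_mul hG hGpos (integrable_gaussianSmoothing _))
  refine ⟨hint, fun i j => ?_⟩
  have hmap := map_add_const_eq_of_gaussianSmoothing (hw i j)
  have hmean : ∫ x, x ∂(ρ i) = (∫ x, x ∂(ρ j)) + w i j := by
    rw [← hmap, integral_map (by fun_prop) (by fun_prop),
      integral_add (f := fun x => x) (hint j) (by simp)]
    simp
  rw [hmean, add_sub_cancel_left, hmap]

end GaussianSmoothing

section Translates

open ProbabilityTheory
open scoped RealInnerProductSpace

variable {E : Type*} [NormedAddCommGroup E] [InnerProductSpace ℝ E] [FiniteDimensional ℝ E]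
  [MeasurableSpace E] [BorelSpace E] {ι : Type*} [Fintype ι] {c : ι → ℝ}

theorem isProbabilityMeasure_withDensity_volume {f : E → ℝ≥0∞} (hf : ∫⁻ x, f x = 1) :
    IsProbabilityMeasure ((volume : Measure E).withDensity f) :=
  ⟨by rw [withDensity_apply _ MeasurableSet.univ, setLIntegral_univ, hf]⟩

theorem SatisfiesPrekopaLeindler.prod_gaussianSmoothing_le (hPL : SatisfiesPrekopaLeindler E c)
    (hc : ∀ i, 0 < c i) (hsum : ∑ i, c i = 1) {f : ι → E → ℝ≥0∞} {h : E → ℝ≥0∞}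
    (hf : ∀ i, Measurable (f i)) (hh : Measurable h) (hf1 : ∀ i, ∫⁻ x, f i x = 1)
    (hh1 : ∫⁻ x, h x = 1) (hle : ∀ x : ι → E, ∏ i, f i (x i) ^ c i ≤ h (∑ i, c i • x i))
    (L : E →L[ℝ] ℝ) (t : ι → ℝ) :
    ∏ i, gaussianSmoothing ((volume.withDensity (f i)).map L) (t i) ^ c i ≤
      gaussianSmoothing ((volume.withDensity h).map L) (∑ i, c i • t i) := by
  have hpdf := measurable_gaussianPDF 0 1
  have hsmooth : ∀ g : E → ℝ≥0∞, Measurable g → ∫⁻ x, g x = 1 → ∀ s,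
      0 < gaussianSmoothing ((volume.withDensity g).map L) s ∧
      ENNReal.ofReal (gaussianSmoothing ((volume.withDensity g).map L) s) =
        ∫⁻ x, g x * gaussianPDF 0 1 (s - L x) := fun g hg hg1 s => by
    have := isProbabilityMeasure_withDensity_volume hg1
    have : IsProbabilityMeasure ((volume.withDensity g).map L) :=
      Measure.isProbabilityMeasure_map (by fun_prop)
    refine ⟨gaussianSmoothing_pos _ _, ?_⟩
    have hm : Measurable fun y => gaussianPDF 0 1 (s - y) := hpdf.comp (by fun_prop)
    rw [ofReal_gaussianSmoothing, lintegral_map hm (by fun_prop),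
      lintegral_withDensity_eq_lintegral_mul _ hg (by fun_prop)]
    rfl
  have hpos : ∀ i, 0 ≤ gaussianSmoothing ((volume.withDensity (f i)).map L) (t i) := fun i =>
    (hsmooth _ (hf i) (hf1 i) _).1.le
  refine (ENNReal.ofReal_le_ofReal_iff (hsmooth h hh hh1 _).1.le).1 ?_
  rw [ENNReal.ofReal_prod_of_nonneg fun i _ => Real.rpow_nonneg (hpos i) _,
    (hsmooth h hh hh1 _).2]
  simp only [← ENNReal.ofReal_rpow_of_nonneg (hpos _) (hc _).le,
    fun i => (hsmooth _ (hf i) (hf1 i) (t i)).2]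
  refine hPL _ _ (fun i => (hf i).mul (hpdf.comp (by fun_prop)))
    (hh.mul (hpdf.comp (by fun_prop))) fun x => ?_
  simp only [ENNReal.mul_rpow_of_nonneg _ _ (hc _).le, Finset.prod_mul_distrib]
  refine mul_le_mul' (hle x) ?_
  simp only [gaussianPDF, ENNReal.ofReal_rpow_of_nonneg (gaussianPDFReal_nonneg _ _ _) (hc _).le]
  rw [← ENNReal.ofReal_prod_of_nonneg fun i _ => Real.rpow_nonneg (gaussianPDFReal_nonneg _ _ _) _]
  refine ENNReal.ofReal_le_ofReal ((prod_gaussianPDFReal_rpow_le hc hsum _).trans_eq ?_)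
  simp [mul_sub]

theorem map_add_const_withDensity_volume {f : E → ℝ≥0∞} (hf : Measurable f) (v : E) :
    ((volume : Measure E).withDensity f).map (· + v) =
      volume.withDensity fun x => f (x - v) := by
  refine Measure.ext_of_lintegral _ fun φ hφ => ?_
  rw [lintegral_map hφ (by fun_prop), lintegral_withDensity_eq_lintegral_mul _ hf (by fun_prop),
    lintegral_withDensity_eq_lintegral_mul _ (by fun_prop) hφ,
    ← lintegral_sub_right_eq_self (f * _) v]
  simp

/-- Equality in the Prékopa–Leindler inequality for probability densities forces the densities
to be translates of each other. -/
theorem SatisfiesPrekopaLeindler.exists_translate [Nontrivial ι]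
    (hPL : SatisfiesPrekopaLeindler E c)
    (hc : ∀ i, 0 < c i) (hsum : ∑ i, c i = 1) {f : ι → E → ℝ≥0∞} {h : E → ℝ≥0∞}
    (hf : ∀ i, Measurable (f i)) (hh : Measurable h) (hf1 : ∀ i, ∫⁻ x, f i x = 1)
    (hh1 : ∫⁻ x, h x = 1) (hle : ∀ x : ι → E, ∏ i, f i (x i) ^ c i ≤ h (∑ i, c i • x i)) :
    ∃ (w : ι → E) (φ : E → ℝ≥0∞), Measurable φ ∧ ∑ i, c i • w i = 0 ∧
      ∀ i, f i =ᵐ[volume] fun x => φ (x + w i) := by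
  have hprob := fun i => isProbabilityMeasure_withDensity_volume (hf1 i)
  have := isProbabilityMeasure_withDensity_volume hh1
  set μ : ι → Measure E := fun i => volume.withDensity (f i) with hμ
  have hmarg : ∀ L : E →L[ℝ] ℝ, (∀ i, Integrable L (μ i)) ∧
      ∀ i j, ((μ j).map L).map (· + ((∫ x, L x ∂(μ i)) - ∫ x, L x ∂(μ j))) = (μ i).map L := by
    intro L
    have hL : Measurable L := by fun_prop
    have : ∀ i, IsProbabilityMeasure ((μ i).map L) := fun i =>
      Measure.isProbabilityMeasure_map hL.aemeasurable
    have : IsProbabilityMeasure ((volume.withDensity h).map L) :=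
      Measure.isProbabilityMeasure_map hL.aemeasurable
    have key := integrable_id_and_map_eq_of_gaussianSmoothing hc hsum
      (hPL.prod_gaussianSmoothing_le hc hsum hf hh hf1 hh1 hle L)
    refine ⟨fun i => ?_, fun i j => ?_⟩
    · exact (integrable_map_measure (by fun_prop) hL.aemeasurable).1 (key.1 i)
    · have := key.2 i j
      rwa [integral_map hL.aemeasurable (by fun_prop),
        integral_map hL.aemeasurable (by fun_prop)] at this
  have hint : ∀ i, Integrable id (μ i) := fun i => by
    refine (integrable_finsetSum Finset.univ fun l _ =>
      ((hmarg (innerSL ℝ (stdOrthonormalBasis ℝ E l))).1 i).smul_const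
        (stdOrthonormalBasis ℝ E l)).congr (ae_of_all _ fun x => ?_)
    simpa using (stdOrthonormalBasis ℝ E).sum_repr' x
  set m : ι → E := fun i => ∫ x, x ∂(μ i) with hm
  have hmean : ∀ (L : E →L[ℝ] ℝ) i, ∫ x, L x ∂(μ i) = L (m i) := fun L i =>
    L.integral_comp_comm (hint i)
  have htrans : ∀ i j, f i =ᵐ[volume] fun x => f j (x - (m i - m j)) := fun i j => by
    have hmap : (μ j).map (· + (m i - m j)) = μ i := by
      have : IsProbabilityMeasure ((μ j).map (· + (m i - m j))) :=
        Measure.isProbabilityMeasure_map (by fun_prop)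
      refine Measure.ext_of_charFun (funext fun u => ?_)
      have h1 := congrArg (fun m => charFun m 1) ((hmarg (innerSL ℝ u)).2 i j)
      rw [charFun_map_add_const] at h1
      rw [charFun_map_add_const]
      simp only [charFun_apply] at h1 ⊢
      rw [integral_map (by fun_prop) (by fun_prop), integral_map (by fun_prop) (by fun_prop),
        hmean, hmean, ← map_sub] at h1
      simpa [real_inner_comm u] using h1
    rw [hμ, map_add_const_withDensity_volume (hf j)] at hmap
    exact ((withDensity_eq_iff (by fun_prop) (hf i).aemeasurable
      (by simp [lintegral_sub_right_eq_self (f j), hf1])).1 hmap).symm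
  obtain ⟨i₀⟩ : Nonempty ι := inferInstance
  refine ⟨fun i => ∑ j, c j • m j - m i, fun x => f i₀ (x + m i₀ - ∑ j, c j • m j), by fun_prop,
    ?_, fun i => (htrans i i₀).trans (ae_of_all _ fun x => ?_)⟩
  · simp only [smul_sub, Finset.sum_sub_distrib]
    rw [← Finset.sum_smul, hsum, one_smul, sub_self]
  · simp only
    congr 1
    abel

end Translates

section Representative

open Metric

variable {ι : Type*} [Fintype ι] {c : ι → ℝ}

theorem ENNReal.prod_const_rpow (hc : ∀ i, 0 ≤ c i) (a : ℝ≥0∞) :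
    ∏ i, a ^ c i = a ^ ∑ i, c i := by
  classical
  induction (Finset.univ : Finset ι) using Finset.induction_on with
  | empty => simp
  | insert i s hi ih =>
    rw [Finset.prod_insert hi, Finset.sum_insert hi, ih,
      ENNReal.rpow_add_of_nonneg _ _ (hc i) (Finset.sum_nonneg fun j _ => hc j)]

theorem ennreal_rpow_mul_rpow_le_of_prod_le {V : Type*} [AddCommGroup V] [Module ℝ V]
    [TopologicalSpace V] [IsTopologicalAddGroup V] [ContinuousSMul ℝ V] [Nontrivial ι]
    (hc : ∀ i, 0 < c i) (hsum : ∑ i, c i = 1) {a : V → ℝ≥0∞} (ha : Continuous a)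
    (hfin : ∀ x, a x ≠ ∞) (h : ∀ z : ι → V, ∏ i, a (z i) ^ c i ≤ a (∑ i, c i • z i))
    (x y : V) {t : ℝ} (ht0 : 0 < t) (ht1 : t < 1) :
    a x ^ (1 - t) * a y ^ t ≤ a ((1 - t) • x + t • y) := by
  have hlc : IsLogConcave fun x => (a x).toReal := by
    refine isLogConcave_of_prod_le hc hsum
      (ENNReal.continuousOn_toReal.comp_continuous ha hfin) (fun _ => ENNReal.toReal_nonneg)
      fun z => ?_
    have := ENNReal.toReal_mono (hfin _) (h z)
    simpa [ENNReal.toReal_prod, ENNReal.toReal_rpow] using this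
  have := hlc x y t ht0 ht1
  simp only [ENNReal.toReal_rpow, ← ENNReal.toReal_mul] at this
  refine (ENNReal.toReal_le_toReal (ENNReal.mul_ne_top ?_ ?_) (hfin _)).1 this
  · exact ENNReal.rpow_ne_top_of_nonneg (sub_pos.2 ht1).le (hfin x)
  · exact ENNReal.rpow_ne_top_of_nonneg ht0.le (hfin y)

theorem ennreal_rpow_mul_rpow_iSup_le {V : Type*} [AddCommGroup V] [Module ℝ V]
    {a : ℕ → V → ℝ≥0∞} (hmono : Monotone a) {t : ℝ} (ht0 : 0 < t) (ht1 : t < 1) {x y : V}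
    (h : ∀ n, a n x ^ (1 - t) * a n y ^ t ≤ a n ((1 - t) • x + t • y)) :
    (⨆ n, a n x) ^ (1 - t) * (⨆ n, a n y) ^ t ≤ ⨆ n, a n ((1 - t) • x + t • y) := by
  rw [← ENNReal.orderIsoRpow_apply _ (sub_pos.2 ht1), ← ENNReal.orderIsoRpow_apply _ ht0,
    OrderIso.map_iSup, OrderIso.map_iSup, ENNReal.iSup_mul]
  simp only [ENNReal.mul_iSup, ENNReal.orderIsoRpow_apply]
  refine iSup_le fun n => iSup_le fun m => ?_
  refine le_trans ?_ ((h (max n m)).trans (le_iSup (fun n => a n _) (max n m)))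
  exact mul_le_mul' (ENNReal.rpow_le_rpow (hmono (le_max_left n m) x) (sub_pos.2 ht1).le)
    (ENNReal.rpow_le_rpow (hmono (le_max_right n m) y) ht0.le)

variable {E : Type*} [NormedAddCommGroup E] [InnerProductSpace ℝ E] [FiniteDimensional ℝ E]
  [MeasurableSpace E] [BorelSpace E]

theorem continuous_setLIntegral_closedBall {φ : E → ℝ≥0∞} (hφ : Measurable φ)
    (hfin : ∫⁻ x, φ x ≠ ∞) {ε : ℝ} (hε : 0 < ε) :
    Continuous fun x => ∫⁻ z in closedBall x ε, φ z := by
  refine continuous_iff_continuousAt.2 fun x₀ => ?_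
  simp only [ContinuousAt, ← lintegral_indicator isClosed_closedBall.measurableSet]
  refine tendsto_lintegral_filter_of_dominated_convergence φ
    (Eventually.of_forall fun x => hφ.indicator isClosed_closedBall.measurableSet)
    (Eventually.of_forall fun x => ae_of_all _ fun z => indicator_le_self _ _ z) hfin ?_
  have hsphere : ∀ᵐ z : E, z ∉ sphere x₀ ε :=
    measure_eq_zero_iff_ae_notMem.1 (Measure.addHaar_sphere_of_ne_zero volume x₀ hε.ne')
  filter_upwards [hsphere] with z hz
  refine tendsto_const_nhds.congr' ?_
  have hcont : Continuous fun x => dist z x := by fun_prop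
  rcases lt_or_gt_of_ne (show dist z x₀ ≠ ε from hz) with h | h
  · filter_upwards [hcont.continuousAt.eventually_lt_const h] with x hx
    rw [indicator_of_mem (mem_closedBall.2 h.le), indicator_of_mem (mem_closedBall.2 hx.le)]
  · filter_upwards [hcont.continuousAt.eventually_const_lt h] with x hx
    rw [indicator_of_notMem (by simpa using h), indicator_of_notMem (by simpa using hx)]

theorem SatisfiesPrekopaLeindler.prod_setLIntegral_closedBall_le
    (hPL : SatisfiesPrekopaLeindler E c) (hc : ∀ i, 0 < c i) (hsum : ∑ i, c i = 1)
    {f : ι → E → ℝ≥0∞} {h : E → ℝ≥0∞} (hf : ∀ i, Measurable (f i)) (hh : Measurable h)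
    (hle : ∀ x : ι → E, ∏ i, f i (x i) ^ c i ≤ h (∑ i, c i • x i)) (x : ι → E) (ε : ℝ) :
    ∏ i, (∫⁻ z in closedBall (x i) ε, f i z) ^ c i ≤
      ∫⁻ z in closedBall (∑ i, c i • x i) ε, h z := by
  simp only [← lintegral_indicator isClosed_closedBall.measurableSet]
  refine hPL _ _ (fun i => (hf i).indicator isClosed_closedBall.measurableSet)
    (hh.indicator isClosed_closedBall.measurableSet) fun y => ?_
  by_cases hy : ∀ i, y i ∈ closedBall (x i) ε
  · rw [indicator_of_mem]
    · simpa only [indicator_of_mem (hy _)] using hle y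
    · simp only [mem_closedBall, dist_eq_norm] at hy ⊢
      calc ‖∑ i, c i • y i - ∑ i, c i • x i‖ = ‖∑ i, c i • (y i - x i)‖ := by
            simp only [smul_sub, Finset.sum_sub_distrib]
        _ ≤ ∑ i, c i * ε := norm_sum_le_of_le _ fun i _ => by
            rw [norm_smul, Real.norm_of_nonneg (hc i).le]
            exact mul_le_mul_of_nonneg_left (hy i) (hc i).le
        _ = ε := by rw [← Finset.sum_mul, hsum, one_mul]
  · obtain ⟨i, hi⟩ := not_forall.1 hy
    rw [Finset.prod_eq_zero (Finset.mem_univ i)]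
    · exact zero_le
    · rw [indicator_of_notMem hi, ENNReal.zero_rpow_of_pos (hc i)]

theorem ae_iSup_iInf_average_closedBall_eq {φ : E → ℝ≥0∞} (hφ : Measurable φ)
    (hfin : ∫⁻ x, φ x ≠ ∞) {ε : ℕ → ℝ} (hε : ∀ n, 0 < ε n) (hlim : Tendsto ε atTop (𝓝 0)) :
    (fun x => ⨆ n, ⨅ m ≥ n, (∫⁻ z in closedBall x (ε m), φ z) *
      (volume (closedBall (0 : E) (ε m)))⁻¹) =ᵐ[volume] φ := by
  filter_upwards [(Besicovitch.vitaliFamily (volume : Measure E)).ae_tendsto_lintegral_div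
    hφ.aemeasurable hfin] with x hx
  have h1 : Tendsto ε atTop (𝓝[>] 0) :=
    tendsto_nhdsWithin_iff.2 ⟨hlim, Eventually.of_forall hε⟩
  have h2 := (hx.comp ((Besicovitch.tendsto_filterAt volume x).comp h1)).liminf_eq
  rw [liminf_eq_iSup_iInf_of_nat] at h2
  rw [← h2]
  simp [div_eq_mul_inv, Measure.addHaar_closedBall_center volume x]

/-- An integrable function that satisfies the Prékopa–Leindler inequality with equality agrees
almost everywhere with a log-concave function. -/
theorem SatisfiesPrekopaLeindler.exists_isLogConcave_ae_eq [Nontrivial ι]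
    (hPL : SatisfiesPrekopaLeindler E c) (hc : ∀ i, 0 < c i) (hsum : ∑ i, c i = 1)
    {f : ι → E → ℝ≥0∞} {φ h : E → ℝ≥0∞} (hf : ∀ i, Measurable (f i)) (hφ : Measurable φ)
    (hh : Measurable h) (hfφ : ∀ i, f i =ᵐ[volume] φ) (hφ1 : ∫⁻ x, φ x = 1)
    (hh1 : ∫⁻ x, h x = 1)
    (hle : ∀ x : ι → E, ∏ i, f i (x i) ^ c i ≤ h (∑ i, c i • x i)) :
    ∃ ψ : E → ℝ, (∀ x, 0 ≤ ψ x) ∧ IsLogConcave ψ ∧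
      φ =ᵐ[volume] fun x => ENNReal.ofReal (ψ x) := by
  have hφh : φ =ᵐ[volume] h := by
    refine ae_eq_of_ae_le_of_lintegral_le ?_ (by simp [hφ1]) hh.aemeasurable (by rw [hφ1, hh1])
    filter_upwards [eventually_all.2 hfφ] with x hx
    have := hle fun _ => x
    rwa [Finset.prod_congr rfl fun i _ => by rw [hx i],
      ENNReal.prod_const_rpow fun i => (hc i).le, ← Finset.sum_smul, hsum, ENNReal.rpow_one,
      one_smul] at this
  have hfin : ∫⁻ x, φ x ≠ ∞ := by simp [hφ1]
  obtain ⟨ε, -, hε, hlim⟩ := exists_seq_strictAnti_tendsto (0 : ℝ)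
  set a : ℕ → E → ℝ≥0∞ := fun m x => (∫⁻ z in closedBall x (ε m), φ z) *
    (volume (closedBall (0 : E) (ε m)))⁻¹ with ha
  have hV0 : ∀ m, volume (closedBall (0 : E) (ε m)) ≠ 0 := fun m =>
    (measure_closedBall_pos _ _ (hε m)).ne'
  have ha_fin : ∀ m x, a m x ≠ ∞ := fun m x =>
    ENNReal.mul_ne_top ((setLIntegral_le_lintegral _ _).trans_lt hfin.lt_top).ne
      (ENNReal.inv_ne_top.2 (hV0 m))
  have ha_lc : ∀ m x y (t : ℝ), 0 < t → t < 1 →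
      a m x ^ (1 - t) * a m y ^ t ≤ a m ((1 - t) • x + t • y) := by
    intro m x y t ht0 ht1
    refine ennreal_rpow_mul_rpow_le_of_prod_le hc hsum ?_ (ha_fin m) (fun z => ?_) x y ht0 ht1
    · exact ENNReal.continuous_mul_const (ENNReal.inv_ne_top.2 (hV0 m)) |>.comp
        (continuous_setLIntegral_closedBall hφ hfin (hε m))
    · simp only [ha, ENNReal.mul_rpow_of_nonneg _ _ (hc _).le, Finset.prod_mul_distrib]
      rw [ENNReal.prod_const_rpow fun i => (hc i).le, hsum, ENNReal.rpow_one]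
      gcongr
      have := hPL.prod_setLIntegral_closedBall_le hc hsum hf hh hle z (ε m)
      rw [setLIntegral_congr_fun_ae isClosed_closedBall.measurableSet
        (hφh.mono fun x hx _ => hx)]
      refine le_trans (le_of_eq (Finset.prod_congr rfl fun i _ => ?_)) this
      rw [setLIntegral_congr_fun_ae isClosed_closedBall.measurableSet
        ((hfφ i).mono fun x hx _ => hx)]
  set b : ℕ → E → ℝ≥0∞ := fun n x => ⨅ m ≥ n, a m x with hb
  have hbmono : Monotone b := fun n n' hn x => le_iInf₂ fun m hm => iInf₂_le m (hn.trans hm)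
  set Ψ : E → ℝ≥0∞ := fun x => ⨆ n, b n x with hΨ
  have hΨφ : Ψ =ᵐ[volume] φ := ae_iSup_iInf_average_closedBall_eq hφ hfin hε hlim
  have hΨ_lc : ∀ x y (t : ℝ), 0 < t → t < 1 →
      Ψ x ^ (1 - t) * Ψ y ^ t ≤ Ψ ((1 - t) • x + t • y) := fun x y t ht0 ht1 => by
    refine ennreal_rpow_mul_rpow_iSup_le hbmono ht0 ht1 fun n => le_iInf₂ fun m hm => ?_
    refine le_trans ?_ (ha_lc m x y t ht0 ht1)
    exact mul_le_mul' (ENNReal.rpow_le_rpow (iInf₂_le m hm) (sub_pos.2 ht1).le)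
      (ENNReal.rpow_le_rpow (iInf₂_le m hm) ht0.le)
  have hΨfin : ∀ x, Ψ x ≠ ∞ := by
    intro x hx
    have hnull : volume {z | Ψ z = ∞} = 0 := by
      refine measure_mono_null (fun z hz => ?_)
        (ae_iff.1 ((ae_lt_top hφ hfin).and hΨφ))
      simp only [mem_ofPred_eq, not_and] at hz ⊢
      intro h1 h2
      exact h1.ne (h2 ▸ hz)
    have hsub : AffineMap.homothety x (1 / 2 : ℝ) '' {y | Ψ y ≠ 0} ⊆ {z | Ψ z = ∞} := by
      rintro _ ⟨y, hy, rfl⟩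
      have h1 := hΨ_lc x y (1 / 2) (by norm_num) (by norm_num)
      rw [hx, ENNReal.top_rpow_of_pos (by norm_num), ENNReal.top_mul, top_le_iff] at h1
      · rw [mem_ofPred_eq, ← h1, AffineMap.homothety_apply]
        congr 1
        simp only [vsub_eq_sub, vadd_eq_add]
        module
      · simpa [ENNReal.rpow_eq_zero_iff] using hy
    have hzero := measure_mono_null hsub hnull
    rw [Measure.addHaar_image_homothety, mul_eq_zero] at hzero
    have hΨ0 : volume {y | Ψ y ≠ 0} = 0 := hzero.resolve_left (by simp)
    have hφ0 : φ =ᵐ[volume] 0 := hΨφ.symm.trans (ae_iff.2 hΨ0)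
    rw [lintegral_congr_ae hφ0] at hφ1
    simp at hφ1
  refine ⟨fun x => (Ψ x).toReal, fun _ => ENNReal.toReal_nonneg, fun x y t ht0 ht1 => ?_, ?_⟩
  · have := ENNReal.toReal_mono (hΨfin _) (hΨ_lc x y t ht0 ht1)
    simpa [ENNReal.toReal_mul, ENNReal.toReal_rpow] using this
  · filter_upwards [hΨφ] with x hx
    rw [ENNReal.ofReal_toReal (hΨfin x), hx]

end Representative

theorem exists_measurable_lintegral_eq_outerLintegral {α : Type*} [MeasurableSpace α]
    (μ : Measure α) (f : α → ℝ≥0∞) :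
    ∃ h, Measurable h ∧ (∀ x, f x ≤ h x) ∧ ∫⁻ x, h x ∂μ = outerLintegral μ f := by
  have hle : ∀ h, Measurable h → (∀ x, f x ≤ h x) → outerLintegral μ f ≤ ∫⁻ x, h x ∂μ :=
    fun h hm hf => iInf_le_of_le h (iInf_le_of_le hm (iInf_le_of_le hf le_rfl))
  rcases eq_or_ne (outerLintegral μ f) ∞ with htop | htop
  · exact ⟨fun _ => ∞, measurable_const, fun _ => le_top,
      le_antisymm (le_top.trans_eq htop.symm) (hle _ measurable_const fun _ => le_top)⟩
  have hex : ∀ n : ℕ, ∃ h, Measurable h ∧ (∀ x, f x ≤ h x) ∧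
      ∫⁻ x, h x ∂μ < outerLintegral μ f + ((n : ℝ≥0∞) + 1)⁻¹ := fun n => by
    have : outerLintegral μ f < outerLintegral μ f + ((n : ℝ≥0∞) + 1)⁻¹ :=
      ENNReal.lt_add_right htop (by simp)
    conv_lhs at this => unfold outerLintegral
    simpa only [iInf_lt_iff, exists_prop] using this
  choose h hm hf hlt using hex
  have hmeas : Measurable fun x => ⨅ n, h n x := Measurable.iInf hm
  have hfle : ∀ x, f x ≤ ⨅ n, h n x := fun x => le_iInf fun n => hf n x
  refine ⟨fun x => ⨅ n, h n x, hmeas, hfle, le_antisymm ?_ (hle _ hmeas hfle)⟩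
  have hlim : Tendsto (fun n : ℕ => outerLintegral μ f + ((n : ℝ≥0∞) + 1)⁻¹) atTop
      (𝓝 (outerLintegral μ f)) := by
    have h1 := (tendsto_add_atTop_iff_nat 1).2 ENNReal.tendsto_inv_nat_nhds_zero
    simpa using tendsto_const_nhds.add h1
  exact ge_of_tendsto' hlim fun n =>
    (lintegral_mono fun x => iInf_le (fun n => h n x) n).trans (hlt n).le

theorem exists_measurable_le_ae_eq {α : Type*} [MeasurableSpace α] {μ : Measure α}
    {f : α → ℝ≥0∞} (hf : AEMeasurable f μ) (hfin : ∫⁻ x, f x ∂μ ≠ ∞) :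
    ∃ g, Measurable g ∧ (∀ x, g x ≤ f x) ∧ g =ᵐ[μ] f := by
  obtain ⟨g, hg, hle, heq⟩ := exists_measurable_le_lintegral_eq μ f
  exact ⟨g, hg, hle, ae_eq_of_ae_le_of_lintegral_le (ae_of_all _ hle) (heq ▸ hfin) hf heq.le⟩

section Equality

variable {E : Type*} [NormedAddCommGroup E] [InnerProductSpace ℝ E] [FiniteDimensional ℝ E]
  [MeasurableSpace E] [BorelSpace E] {ι : Type*} [Fintype ι] [Nontrivial ι] {c : ι → ℝ}

/-- Probability densities achieving equality in the Prékopa–Leindler inequality are translates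
of a log-concave function. -/
theorem SatisfiesPrekopaLeindler.exists_isLogConcave_translate
    (hPL : SatisfiesPrekopaLeindler E c) (hc : ∀ i, 0 < c i) (hsum : ∑ i, c i = 1)
    {f : ι → E → ℝ≥0∞} {h : E → ℝ≥0∞} (hf : ∀ i, Measurable (f i)) (hh : Measurable h)
    (hf1 : ∀ i, ∫⁻ x, f i x = 1) (hh1 : ∫⁻ x, h x = 1)
    (hle : ∀ x : ι → E, ∏ i, f i (x i) ^ c i ≤ h (∑ i, c i • x i)) :
    ∃ (w : ι → E) (ψ : E → ℝ), ∑ i, c i • w i = 0 ∧ (∀ x, 0 ≤ ψ x) ∧ IsLogConcave ψ ∧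
      ∀ i, f i =ᵐ[volume] fun x => ENNReal.ofReal (ψ (x + w i)) := by
  obtain ⟨w, φ, hφ, hw, hfφ⟩ := hPL.exists_translate hc hsum hf hh hf1 hh1 hle
  have hfφ' : ∀ i, (fun x => f i (x - w i)) =ᵐ[volume] φ := fun i => by
    have := (measurePreserving_sub_right volume (w i)).quasiMeasurePreserving.ae_eq_comp (hfφ i)
    simpa [Function.comp_def] using this
  obtain ⟨i₀⟩ : Nonempty ι := inferInstance
  have hφ1 : ∫⁻ x, φ x = 1 := by
    rw [← lintegral_congr_ae (hfφ' i₀), lintegral_sub_right_eq_self (f i₀), hf1]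
  obtain ⟨ψ, hψ0, hψ, hφψ⟩ := hPL.exists_isLogConcave_ae_eq hc hsum
    (f := fun i x => f i (x - w i)) (fun i => by fun_prop) hφ hh hfφ' hφ1 hh1 fun x => by
      simpa [smul_sub, hw] using hle fun i => x i - w i
  refine ⟨w, ψ, hw, hψ0, hψ, fun i => (hfφ i).trans ?_⟩
  exact (measurePreserving_add_right volume (w i)).quasiMeasurePreserving.ae_eq_comp hφψ

/-- Equality in the Prékopa–Leindler inequality, for functions of arbitrary finite positive
integral. -/
theorem SatisfiesPrekopaLeindler.exists_isLogConcave_smul_translate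
    (hPL : SatisfiesPrekopaLeindler E c) (hc : ∀ i, 0 < c i) (hsum : ∑ i, c i = 1)
    {f : ι → E → ℝ≥0∞} {h : E → ℝ≥0∞} (hf : ∀ i, Measurable (f i)) (hh : Measurable h)
    (hf0 : ∀ i, ∫⁻ x, f i x ≠ 0) (hfin : ∀ i, ∫⁻ x, f i x ≠ ∞)
    (hheq : ∫⁻ x, h x = ∏ i, (∫⁻ x, f i x) ^ c i)
    (hle : ∀ x : ι → E, ∏ i, f i (x i) ^ c i ≤ h (∑ i, c i • x i)) :
    ∃ (w : ι → E) (ψ : E → ℝ), ∑ i, c i • w i = 0 ∧ (∀ x, 0 ≤ ψ x) ∧ IsLogConcave ψ ∧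
      ∀ i, f i =ᵐ[volume] fun x => (∫⁻ x, f i x) * ENNReal.ofReal (ψ (x + w i)) := by
  set C : ι → ℝ≥0∞ := fun i => ∫⁻ x, f i x
  set D := ∏ i, C i ^ c i
  have hD0 : D ≠ 0 := Finset.prod_ne_zero_iff.2 fun i _ => by
    simp [ENNReal.rpow_eq_zero_iff, hf0 i, (hc i).not_gt, C]
  have hDfin : D ≠ ∞ := ENNReal.prod_ne_top fun i _ =>
    ENNReal.rpow_ne_top_of_nonneg (hc i).le (hfin i)
  have hDinv : ∏ i, (C i)⁻¹ ^ c i = D⁻¹ := by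
    rw [ENNReal.prod_inv_distrib fun i _ j _ _ => Or.inr
      (ENNReal.rpow_ne_top_of_nonneg (hc j).le (hfin j))]
    exact Finset.prod_congr rfl fun i _ => ENNReal.inv_rpow _ _
  obtain ⟨w, ψ, hw, hψ0, hψ, hfψ⟩ := hPL.exists_isLogConcave_translate hc hsum
    (f := fun i x => (C i)⁻¹ * f i x) (h := fun x => D⁻¹ * h x) (fun i => by fun_prop)
    (by fun_prop)
    (fun i => by rw [lintegral_const_mul _ (hf i), ENNReal.inv_mul_cancel (hf0 i) (hfin i)])
    (by rw [lintegral_const_mul _ hh, hheq, ENNReal.inv_mul_cancel hD0 hDfin]) fun x => by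
      simp only [ENNReal.mul_rpow_of_nonneg _ _ (hc _).le, Finset.prod_mul_distrib, hDinv]
      gcongr
      exact hle x
  refine ⟨w, ψ, hw, hψ0, hψ, fun i => ?_⟩
  filter_upwards [hfψ i] with x hx
  rw [← hx, ENNReal.mul_inv_cancel_left (hf0 i) (hfin i)]

end Equality

/-- The Prékopa--Leindler inequality together with the characterization of its equality
case: for `c₁,…,c_k > 0` summing to `1` (`k ≥ 2`) and non-negative `fᵢ ∈ L¹(ℝⁿ)`,
`∫* sup_{x = ∑ cᵢxᵢ} ∏ fᵢ(xᵢ)^{cᵢ} dx ≥ ∏ (∫ fᵢ)^{cᵢ}`; and if all `∫ fᵢ > 0` and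
equality holds, then there are `aᵢ > 0`, `wᵢ` with `∑ cᵢwᵢ = 0`, and a log-concave `φ`
with `fᵢ(x) = aᵢ φ(x + wᵢ)` for a.e. `x`. -/
theorem prekopa_leindler_with_equality
    {n k : ℕ} (hk : 2 ≤ k) (c : Fin k → ℝ) (hc : ∀ i, 0 < c i) (hsum : ∑ i, c i = 1)
    (f : Fin k → EuclideanSpace ℝ (Fin n) → ℝ)
    (hf : ∀ i, Integrable (f i)) (hf0 : ∀ i x, 0 ≤ f i x) :
    (∏ i, (∫⁻ x, ENNReal.ofReal (f i x)) ^ (c i) ≤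
      outerLintegral volume fun x =>
        ⨆ (y : Fin k → EuclideanSpace ℝ (Fin n)) (_ : x = ∑ i, c i • y i),
          ∏ i, ENNReal.ofReal (f i (y i)) ^ (c i)) ∧
    ((∀ i, 0 < ∫ x, f i x) →
      (outerLintegral volume fun x =>
        ⨆ (y : Fin k → EuclideanSpace ℝ (Fin n)) (_ : x = ∑ i, c i • y i),
          ∏ i, ENNReal.ofReal (f i (y i)) ^ (c i)) =
        ∏ i, (∫⁻ x, ENNReal.ofReal (f i x)) ^ (c i) →
      ∃ (a : Fin k → ℝ) (w : Fin k → EuclideanSpace ℝ (Fin n))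
          (φ : EuclideanSpace ℝ (Fin n) → ℝ),
        (∀ i, 0 < a i) ∧ (∑ i, c i • w i = 0) ∧ (∀ x, 0 ≤ φ x) ∧ IsLogConcave φ ∧
        ∀ i, ∀ᵐ x, f i x = a i * φ (x + w i)) := by
  have hPL := SatisfiesPrekopaLeindler.euclideanSpace hc hsum n
  have : Nontrivial (Fin k) := Fin.nontrivial_iff_two_le.2 hk
  have hfin : ∀ i, ∫⁻ x, ENNReal.ofReal (f i x) ≠ ∞ := fun i => (hf i).lintegral_lt_top.ne
  choose g hg hgle hgae using fun i =>
    exists_measurable_le_ae_eq (hf i).aemeasurable.ennreal_ofReal (hfin i)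
  have hgint : ∀ i, ∫⁻ x, g i x = ∫⁻ x, ENNReal.ofReal (f i x) := fun i =>
    lintegral_congr_ae (hgae i)
  obtain ⟨h, hh, hle, heq⟩ := exists_measurable_lintegral_eq_outerLintegral volume
    fun x => ⨆ (y : Fin k → EuclideanSpace ℝ (Fin n)) (_ : x = ∑ i, c i • y i),
      ∏ i, ENNReal.ofReal (f i (y i)) ^ (c i)
  have hgh : ∀ x : Fin k → EuclideanSpace ℝ (Fin n),
      ∏ i, g i (x i) ^ c i ≤ h (∑ i, c i • x i) := fun x => by
    refine le_trans ?_ ((le_iSup₂ (f := fun (y : Fin k → EuclideanSpace ℝ (Fin n))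
      (_ : ∑ i, c i • x i = ∑ i, c i • y i) => ∏ i, ENNReal.ofReal (f i (y i)) ^ (c i))
      x rfl).trans (hle _))
    exact Finset.prod_le_prod' fun i _ => ENNReal.rpow_le_rpow (hgle i _) (hc i).le
  simp only [← hgint, ← heq]
  refine ⟨hPL g h hg hh hgh, fun hpos hequal => ?_⟩
  have hg0 : ∀ i, ∫⁻ x, g i x ≠ 0 := fun i => by
    have := hpos i
    rw [integral_eq_lintegral_of_nonneg_ae (ae_of_all _ (hf0 i)) (hf i).aestronglyMeasurable,
      ← hgint] at this
    exact (ENNReal.toReal_pos_iff.1 this).1.ne'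
  have hgfin : ∀ i, ∫⁻ x, g i x ≠ ∞ := fun i => hgint i ▸ hfin i
  obtain ⟨w, φ, hw, hφ0, hφ, hgφ⟩ :=
    hPL.exists_isLogConcave_smul_translate hc hsum hg hh hg0 hgfin hequal hgh
  refine ⟨fun i => (∫⁻ x, g i x).toReal, w, φ, fun i => ENNReal.toReal_pos (hg0 i) (hgfin i),
    hw, hφ0, hφ, fun i => ?_⟩
  filter_upwards [hgφ i, hgae i] with x h1 h2
  rw [← ENNReal.toReal_ofReal (hf0 i x), ← h2, h1, ENNReal.toReal_mul,
    ENNReal.toReal_ofReal (hφ0 _)]
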